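/- Define f : ℝ → ℝ by f(x) = (1/(2 log 2)) (1/(π x²) − 1/(x sinh(π x))) for x ≠ 0 and f(0) = π/(12 log 2). Then f is Lebesgue integrable on ℝ and for every t ∈ ℝ, ∫_ℝ e^{i t x} f(x) dx = log(1 + e^{−|t|})/log 2. That is, f is the spectral density of the stationary Gaussian process with covariance function r(t) = log(1 + e^{−|t|})/log 2. -/

import Mathlib

open MeasureTheory

/-- The claimed spectral density of the limit process `Z`. -/
noncomputable def specDensity (x : ℝ) : ℝ :=
  if x = 0 then Real.pi / (12 * Real.log 2)
  else (1 / (2 * Real.log 2)) * (1 / (Real.pi * x ^ 2) - 1 / (x * Real.sinh (Real.pi * x)))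

lemma aux_exp (a y : ℝ) (ha : 0 < a) :
    Integrable (fun t : ℝ => Complex.exp (-(y * t * Complex.I)) * Complex.exp (-(a * |t| : ℝ))) ∧
    ∫ t : ℝ, Complex.exp (-(y * t * Complex.I)) * Complex.exp (-(a * |t| : ℝ))
      = ((2 * a / (a ^ 2 + y ^ 2) : ℝ) : ℂ) := by
  have e1 : Set.EqOn
      (fun t : ℝ => Complex.exp (-(y * t * Complex.I)) * Complex.exp (-(a * |t| : ℝ)))
      (fun t : ℝ => Complex.exp ((a - y * Complex.I) * t)) (Set.Iic 0) := by
    intro t ht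
    have : |t| = -t := abs_of_nonpos ht
    simp only [this, ← Complex.exp_add]
    congr 1
    push_cast
    ring
  have e2 : Set.EqOn
      (fun t : ℝ => Complex.exp (-(y * t * Complex.I)) * Complex.exp (-(a * |t| : ℝ)))
      (fun t : ℝ => Complex.exp ((-a - y * Complex.I) * t)) (Set.Ioi 0) := by
    intro t ht
    have : |t| = t := abs_of_pos ht
    simp only [this, ← Complex.exp_add]
    congr 1
    push_cast
    ring
  have r1 : 0 < ((a : ℂ) - y * Complex.I).re := by simpa using ha
  have r2 : (-(a : ℂ) - y * Complex.I).re < 0 := by simpa using ha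
  have i1 := (integrableOn_exp_mul_complex_Iic r1 0).congr_fun e1.symm measurableSet_Iic
  have i2 := (integrableOn_exp_mul_complex_Ioi r2 0).congr_fun e2.symm measurableSet_Ioi
  refine ⟨?_, ?_⟩
  · rw [← integrableOn_univ, ← Set.Iic_union_Ioi (a := (0 : ℝ))]
    exact i1.union i2
  · rw [← intervalIntegral.integral_Iic_add_Ioi i1 i2,
      setIntegral_congr_fun measurableSet_Iic e1, setIntegral_congr_fun measurableSet_Ioi e2,
      integral_exp_mul_complex_Iic r1, integral_exp_mul_complex_Ioi r2]
    have h1 : (a : ℂ) - y * Complex.I ≠ 0 := fun h => by rw [h] at r1; simp at r1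
    have h2 : -(a : ℂ) - y * Complex.I ≠ 0 := fun h => by rw [h] at r2; simp at r2
    have h3 : (a : ℂ) ^ 2 + y ^ 2 ≠ 0 := by
      have : a ^ 2 + y ^ 2 ≠ 0 := by positivity
      exact_mod_cast this
    push_cast
    simp only [mul_zero, Complex.exp_zero]
    field_simp
    ring_nf
    simp only [Complex.I_sq]
    ring

lemma aux_exp_real (a : ℝ) (ha : 0 < a) :
    Integrable (fun t : ℝ => Real.exp (-(a * |t|))) ∧
    ∫ t : ℝ, Real.exp (-(a * |t|)) = 2 / a := by
  obtain ⟨h1, h2⟩ := aux_exp a 0 ha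
  simp only [Complex.ofReal_zero, zero_mul, neg_zero, Complex.exp_zero, one_mul] at h1 h2
  constructor
  · have := h1.re
    refine this.congr (Filter.Eventually.of_forall fun t => ?_)
    simp only [← Complex.ofReal_neg, ← Complex.ofReal_exp]
    exact Complex.ofReal_re _
  · have : ∫ t : ℝ, Complex.exp (-(a * |t| : ℝ)) = ((∫ t : ℝ, Real.exp (-(a * |t|)) : ℝ) : ℂ) := by
      rw [← integral_complex_ofReal]
      simp only [← Complex.ofReal_neg, ← Complex.ofReal_exp]
    rw [this] at h2
    have h3 := Complex.ofReal_injective h2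
    rw [h3]
    field_simp
    ring

lemma aux_coth (x : ℝ) (hx : x ≠ 0) :
    HasSum (fun n : ℕ => 2 * x / (x ^ 2 + (n + 1) ^ 2))
      (Real.pi * Real.cosh (Real.pi * x) / Real.sinh (Real.pi * x) - 1 / x) := by
  have hz : (x : ℂ) * Complex.I ∈ Complex.integerComplement := by
    rintro ⟨n, hn⟩
    have := congrArg Complex.im hn
    simp at this
    exact hx this.symm
  have h := (summable_cotTerm hz).hasSum
  have h' := cot_series_rep' hz
  rw [← h'] at h
  have h := h.mul_left Complex.I
  rw [← Complex.hasSum_ofReal]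
  have hs : Real.sinh (Real.pi * x) ≠ 0 := by
    rw [Ne, Real.sinh_eq_zero]
    exact mul_ne_zero Real.pi_ne_zero hx
  have hxc : (x : ℂ) ≠ 0 := by exact_mod_cast hx
  have hsc : Complex.sinh (Real.pi * x) ≠ 0 := by
    rw [← Complex.ofReal_mul, ← Complex.ofReal_sinh]
    exact_mod_cast hs
  convert! h using 1
  · funext n
    rw [cotTerm_identity hz]
    have h1 : ((x : ℂ) ^ 2 + (n + 1) ^ 2) ≠ 0 := by
      have : x ^ 2 + ((n : ℝ) + 1) ^ 2 ≠ 0 := by positivity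
      exact_mod_cast this
    have : (x * Complex.I + (n + 1)) * (x * Complex.I - (n + 1)) = -((x : ℂ) ^ 2 + (n + 1) ^ 2) := by
      ring_nf
      simp only [Complex.I_sq]
      ring
    rw [this]
    push_cast
    field_simp
    simp
  · rw [Complex.cot, ← mul_assoc, Complex.cos_mul_I, Complex.sin_mul_I]
    push_cast
    field_simp

lemma aux_csch (x : ℝ) (hx : x ≠ 0) :
    HasSum (fun n : ℕ => (-1 : ℝ) ^ n * (2 / ((n + 1) ^ 2 + x ^ 2)))
      (1 / x ^ 2 - Real.pi / (x * Real.sinh (Real.pi * x))) := by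
  have h1 := aux_coth x hx
  have h2 := aux_coth (x / 2) (by positivity)
  have hinj : Function.Injective (fun m : ℕ => 2 * m + 1) := fun a b h => by
    simp only at h; omega
  have h3 : HasSum (fun n : ℕ => if Odd n then 4 * x / (x ^ 2 + ((n : ℝ) + 1) ^ 2) else 0)
      (Real.pi * Real.cosh (Real.pi * (x / 2)) / Real.sinh (Real.pi * (x / 2)) - 1 / (x / 2)) := by
    rw [← hinj.hasSum_iff]
    · convert! h2 using 1
      funext m
      simp only [Function.comp]
      rw [if_pos ⟨m, rfl⟩]
      have : (x / 2) ^ 2 + ((m : ℝ) + 1) ^ 2 ≠ 0 := by positivity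
      have : x ^ 2 + (((2 * m + 1 : ℕ) : ℝ) + 1) ^ 2 ≠ 0 := by positivity
      field_simp
      push_cast
      ring
    · intro n hn
      rw [if_neg]
      rintro ⟨m, rfl⟩
      exact hn ⟨m, rfl⟩
  have h4 := (h1.sub h3).mul_left (1 / x)
  convert! h4 using 1
  · funext n
    have : x ^ 2 + ((n : ℝ) + 1) ^ 2 ≠ 0 := by positivity
    have : ((n : ℝ) + 1) ^ 2 + x ^ 2 ≠ 0 := by positivity
    split_ifs with h
    · rw [h.neg_one_pow]
      field_simp
      ring
    · rw [Nat.not_odd_iff_even] at h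
      rw [h.neg_one_pow]
      field_simp
      ring
  · have e : Real.pi * x = 2 * (Real.pi * (x / 2)) := by ring
    have hs : Real.sinh (Real.pi * (x / 2)) ≠ 0 := by
      rw [Ne, Real.sinh_eq_zero]
      have := Real.pi_ne_zero
      positivity
    have hc : Real.cosh (Real.pi * (x / 2)) ≠ 0 := (Real.cosh_pos _).ne'
    have hq := Real.cosh_sq (Real.pi * (x / 2))
    rw [e, Real.sinh_two_mul, Real.cosh_two_mul]
    generalize Real.sinh (Real.pi * (x / 2)) = s at *
    generalize Real.cosh (Real.pi * (x / 2)) = c at *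
    field_simp
    linear_combination (Real.pi * x) * hq

noncomputable def auxG (t : ℝ) : ℂ := ((Real.log (1 + Real.exp (-|t|)) : ℝ) : ℂ)

lemma auxG_cont : Continuous auxG := by
  unfold auxG
  refine Complex.continuous_ofReal.comp (Continuous.log (by fun_prop) fun t => ?_)
  positivity

lemma auxG_int : Integrable auxG := by
  have h := (aux_exp_real 1 one_pos).1
  refine h.mono' auxG_cont.aestronglyMeasurable (Filter.Eventually.of_forall fun t => ?_)
  have h0 := Real.exp_pos (-|t|)
  rw [auxG, Complex.norm_real, Real.norm_eq_abs, abs_of_nonneg (Real.log_nonneg (by linarith))]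
  have := Real.log_le_sub_one_of_pos (show 0 < 1 + Real.exp (-|t|) by positivity)
  simp only [one_mul]
  linarith

lemma auxG_four (y : ℝ) (hy : y ≠ 0) :
    ∫ t : ℝ, Complex.exp (-(y * t * Complex.I)) * auxG t
      = ((1 / y ^ 2 - Real.pi / (y * Real.sinh (Real.pi * y)) : ℝ) : ℂ) := by
  let F : ℕ → ℝ → ℂ := fun n t => ((-1 : ℂ) ^ n / (n + 1)) *
    (Complex.exp (-(y * t * Complex.I)) * Complex.exp (-(((n : ℝ) + 1) * |t| : ℝ)))
  have hF : ∀ n, Integrable (F n) := fun n =>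
    (aux_exp (n + 1) y (by positivity)).1.const_mul _
  have hn : ∀ n, ∫ t, ‖F n t‖ = 2 / ((n : ℝ) + 1) ^ 2 := by
    intro n
    have : ∀ t, ‖F n t‖ = (1 / ((n : ℝ) + 1)) * Real.exp (-(((n : ℝ) + 1) * |t|)) := by
      intro t
      have e1 : ‖Complex.exp (-(y * t * Complex.I))‖ = 1 := by
        rw [Complex.norm_exp]; simp
      have e2 : ‖((n : ℂ) + 1)‖ = (n : ℝ) + 1 := by
        rw [← Nat.cast_succ, Complex.norm_natCast]; simp
      simp only [F, norm_mul, norm_div, norm_pow, norm_neg, norm_one, one_pow, e1, e2, one_mul]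
      rw [← Complex.ofReal_neg, Complex.norm_exp_ofReal]
    simp_rw [this]
    rw [integral_const_mul, (aux_exp_real (n + 1) (by positivity)).2]
    field_simp
  have hS : Summable fun n => ∫ t, ‖F n t‖ := by
    simp_rw [hn]
    have h := (summable_nat_add_iff 1).2 (Real.summable_one_div_nat_pow.2 (one_lt_two))
    have := h.mul_left 2
    refine this.congr fun n => ?_
    push_cast
    ring
  have h1 := hasSum_integral_of_summable_integral_norm hF hS
  have h2 : ∫ t, (∑' n, F n t) = ∫ t : ℝ, Complex.exp (-(y * t * Complex.I)) * auxG t := by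
    refine integral_congr_ae ?_
    have : ∀ᵐ t : ℝ, t ≠ 0 := by
      simp [ae_iff]
    filter_upwards [this] with t ht
    have hlt : |(-Real.exp (-|t|))| < 1 := by
      rw [abs_neg, abs_of_pos (Real.exp_pos _), Real.exp_lt_one_iff]
      simpa using ht
    have h := Real.hasSum_pow_div_log_of_abs_lt_one hlt
    have h := (Complex.hasSum_ofReal.2 h.neg).mul_left (Complex.exp (-(y * t * Complex.I)))
    have e : (Complex.exp (-(y * t * Complex.I)) * auxG t) =
      Complex.exp (-(y * t * Complex.I)) *
        (( - -Real.log (1 - -Real.exp (-|t|)) : ℝ) : ℂ) := by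
      rw [auxG, neg_neg, sub_neg_eq_add]
    rw [e, ← h.tsum_eq]
    congr 1
    funext n
    simp only [F]
    have : Complex.exp (-(((n : ℝ) + 1) * |t| : ℝ)) = Complex.exp (-(|t| : ℝ)) ^ (n + 1) := by
      rw [← Complex.exp_nat_mul]
      congr 1
      push_cast
      ring
    rw [this]
    push_cast
    rw [neg_pow (Complex.exp _)]
    ring
  rw [h2] at h1
  refine h1.unique ?_
  have h3 := Complex.hasSum_ofReal.2 (aux_csch y hy)
  convert! h3 using 1
  funext n
  simp only [F]
  rw [integral_const_mul, (aux_exp (n + 1) y (by positivity)).2]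
  have hh : ((n : ℂ) + 1) ≠ 0 := by exact_mod_cast (Nat.succ_ne_zero n)
  push_cast
  field_simp

lemma spec_eq (y : ℝ) (hy : y ≠ 0) :
    1 / y ^ 2 - Real.pi / (y * Real.sinh (Real.pi * y))
      = 2 * Real.pi * Real.log 2 * specDensity y := by
  rw [specDensity, if_neg hy]
  have : Real.log 2 ≠ 0 := (Real.log_pos one_lt_two).ne'
  have := Real.pi_ne_zero
  have hs : Real.sinh (Real.pi * y) ≠ 0 := by
    rw [Ne, Real.sinh_eq_zero]
    exact mul_ne_zero Real.pi_ne_zero hy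
  field_simp

lemma spec_nonneg_le (y : ℝ) (hy : y ≠ 0) :
    0 ≤ 1 / y ^ 2 - Real.pi / (y * Real.sinh (Real.pi * y)) ∧
    1 / y ^ 2 - Real.pi / (y * Real.sinh (Real.pi * y)) ≤ 1 / y ^ 2 := by
  have key : ∀ y : ℝ, 0 < y → 0 ≤ 1 / y ^ 2 - Real.pi / (y * Real.sinh (Real.pi * y)) ∧
    1 / y ^ 2 - Real.pi / (y * Real.sinh (Real.pi * y)) ≤ 1 / y ^ 2 := by
    intro y hy
    have h1 : Real.pi * y ≤ Real.sinh (Real.pi * y) :=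
      Real.self_le_sinh_iff.2 (by positivity)
    have h0 : 0 < Real.pi * y := by positivity
    have hs : 0 < Real.sinh (Real.pi * y) := by linarith
    constructor
    · rw [sub_nonneg, div_le_div_iff₀ (by positivity) (by positivity)]
      nlinarith
    · have : 0 ≤ Real.pi / (y * Real.sinh (Real.pi * y)) := by positivity
      linarith
  rcases lt_or_gt_of_ne hy with h | h
  · have := key (-y) (by linarith)
    simpa using this
  · exact key y h

lemma spec_meas : Measurable specDensity := by
  unfold specDensity
  refine Measurable.ite (measurableSet_singleton 0) measurable_const ?_
  have := Real.measurable_sinh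
  fun_prop

lemma spec_int : Integrable specDensity := by
  have hl : 0 < Real.log 2 := Real.log_pos one_lt_two
  have hp := Real.pi_pos
  have hc : 0 < 2 * Real.pi * Real.log 2 := by positivity
  suffices h : Integrable (fun y => 2 * Real.pi * Real.log 2 * specDensity y) by
    have := h.const_mul (2 * Real.pi * Real.log 2)⁻¹
    refine this.congr (Filter.Eventually.of_forall fun y => ?_)
    simp only
    field_simp
  set M := ∫ t, ‖auxG t‖ with hM
  refine (integrable_inv_one_add_sq.const_mul (M + 1)).mono'
    (spec_meas.const_mul _).aestronglyMeasurable ?_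
  have : ∀ᵐ t : ℝ, t ≠ 0 := by
    simp [ae_iff]
  filter_upwards [this] with y hy
  rw [← spec_eq y hy]
  obtain ⟨h0, h1⟩ := spec_nonneg_le y hy
  have hb : ‖1 / y ^ 2 - Real.pi / (y * Real.sinh (Real.pi * y))‖ ≤ M := by
    rw [← Complex.norm_real, ← auxG_four y hy]
    refine (norm_integral_le_integral_norm _).trans (le_of_eq ?_)
    congr 1
    funext t
    rw [norm_mul, Complex.norm_exp]
    simp
  rw [Real.norm_eq_abs, abs_of_nonneg h0] at hb ⊢
  generalize 1 / y ^ 2 - Real.pi / (y * Real.sinh (Real.pi * y)) = q at *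
  rw [← div_eq_mul_inv, le_div_iff₀ (by positivity)]
  have : 0 < y ^ 2 := by positivity
  rw [le_div_iff₀ this] at h1
  linarith

open FourierTransform in
lemma four_ae : (𝓕 auxG : ℝ → ℂ) =ᵐ[volume]
    fun w => ((2 * Real.pi * Real.log 2 * specDensity (2 * Real.pi * w) : ℝ) : ℂ) := by
  have : ∀ᵐ t : ℝ, t ≠ 0 := by
    simp [ae_iff]
  filter_upwards [this] with w hw
  have hy : 2 * Real.pi * w ≠ 0 := by
    have := Real.pi_ne_zero
    positivity
  rw [← spec_eq _ hy, ← auxG_four _ hy, Real.fourier_real_eq_integral_exp_smul]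
  congr 1
  funext t
  rw [smul_eq_mul]
  congr 2
  push_cast
  ring

open FourierTransform in
theorem stmt13 :
    Integrable specDensity (volume : Measure ℝ) ∧
    ∀ t : ℝ,
      (∫ x : ℝ, Complex.exp (Complex.I * t * x) * (specDensity x : ℂ))
        = ((Real.log (1 + Real.exp (-|t|)) / Real.log 2 : ℝ) : ℂ) := by
  refine ⟨spec_int, fun t => ?_⟩
  have hl : Real.log 2 ≠ 0 := (Real.log_pos one_lt_two).ne'
  have hp := Real.pi_pos
  have hF : Integrable (𝓕 auxG : ℝ → ℂ) := by
    refine Integrable.congr ?_ four_ae.symm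
    have := (spec_int.comp_mul_left' (R := 2 * Real.pi) (by positivity)).const_mul
      (2 * Real.pi * Real.log 2)
    exact this.ofReal
  have h := congrFun (auxG_cont.fourierInv_fourier_eq auxG_int hF) t
  rw [Real.fourierInv_eq'] at h
  have h2 : ∫ w : ℝ, Complex.exp (((2 * Real.pi * inner ℝ w t : ℝ) : ℂ) * Complex.I) • (𝓕 auxG) w
      = ∫ w : ℝ, (fun x : ℝ => (2 * Real.pi * Real.log 2 : ℂ) *
        (Complex.exp (Complex.I * t * x) * (specDensity x : ℂ))) (2 * Real.pi * w) := by
    refine integral_congr_ae ?_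
    filter_upwards [four_ae] with w hw
    rw [hw, smul_eq_mul]
    have : (((2 * Real.pi * inner ℝ w t : ℝ) : ℂ) * Complex.I)
       = Complex.I * t * ((2 * Real.pi * w : ℝ) : ℂ) := by
      simp only [RCLike.inner_apply, conj_trivial]
      push_cast
      ring
    rw [this]
    push_cast
    ring
  have h3 := Measure.integral_comp_mul_left (fun x : ℝ => (2 * Real.pi * Real.log 2 : ℂ) *
        (Complex.exp (Complex.I * t * x) * (specDensity x : ℂ))) (2 * Real.pi)
  rw [h2, h3, integral_const_mul, abs_of_pos (by positivity)] at h
  rw [auxG] at h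
  have hlc : (Real.log 2 : ℂ) ≠ 0 := by exact_mod_cast hl
  have hpc : (Real.pi : ℂ) ≠ 0 := by exact_mod_cast hp.ne'
  rw [Complex.ofReal_div, eq_div_iff hlc, ← h, Complex.real_smul]
  push_cast
  field_simp
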